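/- Let N ≥ 3, let z = (z₁, z₂) ∈ ℤ² with gcd(z₁,N) = gcd(z₂,N) = 1, let γ₁, γ₂ > 0, and let w₁, w₂ ∈ {1,…,N−1} satisfy w₁ z₁ ≡ z₂ (mod N) and w₂ z₂ ≡ z₁ (mod N). Consider the optimal vertex modified lattice rule Q* whose nodes are the four vertices a ∈ {0,1}² with weights w*(a) = 1/4 − (1/N) ∑_{k=1}^{N−1} ℓ_{supp(a)}({zk/N}) (where ℓ_u(x) = ∏_{j∈u} x_j ∏_{j∉u}(1−x_j)) together with the points {zk/N}, k = 1,…,N−1, each with weight 1/N. Then for the unanchored Sobolev kernel K(x,y) = ∏_{j=1,2}(1 + γ_j B₁(x_j)B₁(y_j) + γ_j B₂({x_j−y_j})/2): ∑_{p,q} w_p w_q K(x_p, x_q) − 1 = [(1/N²) ∑_{k,ℓ=0}^{N−1} ∏_{j=1,2}(1 + γ_j B₂({z_j(k−ℓ)/N})/2) − 1] + (γ₁γ₂/(8π²N²)) ∑_{j∈{1,2}} ∑_{h ≥ 1, N ∤ h} cot²(π h w_j/N)/h², i.e., the squared worst-case error of Q* in the two-dimensional unanchored Sobolev space equals the squared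 worst-case error of the lattice rule in the Korobov space with weights γ/(2π)² plus the cotangent mixture term. -/

import Mathlib

open Finset Real

/-- Multiplication by a unit modulo `N` permutes a complete residue system. -/
lemma sum_range_comp_mul_of_gcd_eq_one {N : ℕ} (hN : 0 < N) {z : ℤ} (hz : Int.gcd z N = 1)
    (f : ℤ → ℝ) (hf : ∀ a b : ℤ, a ≡ b [ZMOD (N : ℤ)] → f a = f b) :
    ∑ k ∈ range N, f (z * k) = ∑ k ∈ range N, f k := by
  have hN' : (0 : ℤ) < N := by exact_mod_cast hN
  have hnn : ∀ m : ℤ, 0 ≤ m % N := fun m => Int.emod_nonneg _ hN'.ne'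
  have hmaps : Set.MapsTo (fun k : ℕ => ((z * k) % (N : ℤ)).toNat) (range N) (range N) := by
    intro k _
    have h1 := hnn (z * k)
    have h2 := Int.emod_lt_of_pos (z * k) hN'
    simp only [coe_range, Set.mem_Iio]
    omega
  have hinj : Set.InjOn (fun k : ℕ => ((z * k) % (N : ℤ)).toNat) (range N) := by
    intro k hk l hl hkl
    simp only [coe_range, Set.mem_Iio] at hk hl
    have h1 := hnn (z * k)
    have h2 := hnn (z * l)
    have h3 : z * k ≡ z * l [ZMOD (N : ℤ)] := by
      simp only [Int.ModEq] at *
      omega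
    have h4 : (k : ℤ) ≡ l [ZMOD (N : ℤ)] := by
      have h5 := Int.ModEq.cancel_left_div_gcd hN' h3
      rwa [Int.gcd_comm, hz, Nat.cast_one, Int.ediv_one] at h5
    have h6 := Int.natCast_modEq_iff.mp h4
    exact Nat.ModEq.eq_of_lt_of_lt h6 hk hl
  refine sum_nbij (fun k : ℕ => ((z * k) % (N : ℤ)).toNat) hmaps hinj
    (surjOn_of_injOn_of_card_le _ hmaps hinj le_rfl) ?_
  intro k _
  apply hf
  rw [Int.toNat_of_nonneg (hnn _)]
  exact (Int.mod_modEq _ _).symm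

/-- The sawtooth function at `m / N`. -/
noncomputable def sawtooth (N : ℕ) (m : ℤ) : ℝ :=
  if (N : ℤ) ∣ m then 0 else Int.fract ((m : ℝ) / N) - 1 / 2

lemma exists_div_eq_add_intCast_of_modEq {N : ℕ} (hN : 0 < N) {a b : ℤ}
    (h : a ≡ b [ZMOD (N : ℤ)]) : ∃ c : ℤ, (b : ℝ) / N = a / N + c := by
  obtain ⟨c, hc⟩ := h.dvd
  have hN' : (N : ℝ) ≠ 0 := by positivity
  refine ⟨c, ?_⟩
  have : (b : ℝ) = a + N * c := by
    rw [sub_eq_iff_eq_add'] at hc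
    exact_mod_cast hc
  rw [this]
  field_simp

lemma fract_div_eq_of_modEq {N : ℕ} (hN : 0 < N) {a b : ℤ} (h : a ≡ b [ZMOD (N : ℤ)]) :
    Int.fract ((a : ℝ) / N) = Int.fract ((b : ℝ) / N) := by
  obtain ⟨c, hc⟩ := exists_div_eq_add_intCast_of_modEq hN h
  rw [hc, Int.fract_add_intCast]

lemma sawtooth_eq_of_modEq {N : ℕ} (hN : 0 < N) {a b : ℤ} (h : a ≡ b [ZMOD (N : ℤ)]) :
    sawtooth N a = sawtooth N b := by
  have : (N : ℤ) ∣ a ↔ (N : ℤ) ∣ b := by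
    rw [Int.dvd_iff_emod_eq_zero, Int.dvd_iff_emod_eq_zero, h]
  simp only [sawtooth, this, fract_div_eq_of_modEq hN h]

lemma fract_div_ne_zero {N : ℕ} (hN : 0 < N) {m : ℤ} (h : ¬ (N : ℤ) ∣ m) :
    Int.fract ((m : ℝ) / N) ≠ 0 := by
  rw [Ne, Int.fract_eq_zero_iff]
  rintro ⟨c, hc⟩
  apply h
  have hN' : (N : ℝ) ≠ 0 := by positivity
  refine ⟨c, ?_⟩
  rw [eq_div_iff hN'] at hc
  rw [mul_comm]
  exact_mod_cast hc.symm

lemma sawtooth_neg {N : ℕ} (hN : 0 < N) (m : ℤ) : sawtooth N (-m) = -sawtooth N m := by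
  by_cases h : (N : ℤ) ∣ m
  · simp [sawtooth, h]
  · simp only [sawtooth, dvd_neg, h, if_false, Int.cast_neg, neg_div,
      Int.fract_neg (fract_div_ne_zero hN h)]
    ring

lemma sum_sawtooth_mul_even {N : ℕ} (hN : 0 < N) (g : ℤ → ℝ)
    (hg : ∀ a b : ℤ, a ≡ b [ZMOD (N : ℤ)] → g a = g b) (heven : ∀ a, g (-a) = g a) :
    ∑ k ∈ range N, sawtooth N k * g k = 0 := by
  have h := sum_range_comp_mul_of_gcd_eq_one hN (z := -1) (by simp)
    (fun m => sawtooth N m * g m)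
    (fun a b hab => by simp only [sawtooth_eq_of_modEq hN hab, hg a b hab])
  simp only [one_mul, sawtooth_neg hN, heven, neg_mul, sum_neg_distrib] at h
  linarith

/-- The `1`-periodic extension of the second Bernoulli polynomial. -/
noncomputable def periodicB2 (t : ℝ) : ℝ := Int.fract t ^ 2 - Int.fract t + 1 / 6

lemma periodicB2_add_intCast (t : ℝ) (c : ℤ) : periodicB2 (t + c) = periodicB2 t := by
  simp [periodicB2]

lemma hasSum_periodicB2 (t : ℝ) :
    HasSum (fun h : ℕ => 1 / π ^ 2 * (cos (2 * π * h * t) / (h : ℝ) ^ 2)) (periodicB2 t) := by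
  have h := (hasSum_one_div_nat_pow_mul_cos one_ne_zero
    ⟨Int.fract_nonneg t, (Int.fract_lt_one t).le⟩).mul_left (1 / π ^ 2)
  have hb : (Polynomial.map (algebraMap ℚ ℝ) (Polynomial.bernoulli (2 * 1))).eval (Int.fract t)
      = periodicB2 t := by
    simp [Polynomial.bernoulli, sum_range_succ, bernoulli, bernoulli'_two, periodicB2,
      Polynomial.eval_add, -one_div]
    ring_nf
  rw [hb] at h
  have hval : 1 / π ^ 2 * ((-1) ^ (1 + 1) * (2 * π) ^ (2 * 1) / 2 / (2 * 1).factorial *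
      periodicB2 t) = periodicB2 t := by
    have := pi_ne_zero
    norm_num [Nat.factorial]
    field_simp
  rw [hval] at h
  refine (congrArg (fun f : ℕ → ℝ => HasSum f _) (funext fun n => ?_)).mp h
  have : cos (2 * π * n * Int.fract t) = cos (2 * π * n * t) := by
    rw [← cos_sub_int_mul_two_pi (2 * π * n * t) (n * ⌊t⌋), Int.fract]
    push_cast
    ring_nf
  rw [this]
  ring

lemma sum_range_mul_sin (θ : ℝ) (n : ℕ) :
    (∑ k ∈ range n, (k : ℝ) * sin (k * θ)) * (4 * sin (θ / 2) ^ 2)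
      = n * sin (n * θ - θ) - (n - 1) * sin (n * θ) := by
  have hs : 4 * sin (θ / 2) ^ 2 = 2 - 2 * cos θ := by
    rw [sin_sq_eq_half_sub, mul_div_cancel₀ _ two_ne_zero]
    ring
  induction n with
  | zero => simp
  | succ n ih =>
    rw [sum_range_succ, add_mul, ih, hs]
    push_cast
    rw [show ((n : ℝ) + 1) * θ - θ = n * θ by ring, show ((n : ℝ) + 1) * θ = n * θ + θ by ring,
      sin_add, sin_sub]
    ring

lemma sawtooth_natCast_of_lt {N k : ℕ} (hk : k < N) :
    sawtooth N k = (k : ℝ) / N - if k = 0 then 0 else 1 / 2 := by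
  by_cases h0 : k = 0
  · simp [sawtooth, h0]
  · have hN : (0 : ℝ) < N := by exact_mod_cast (Nat.zero_le k).trans_lt hk
    have hd : ¬ (N : ℤ) ∣ k := by
      rw [Int.natCast_dvd_natCast]
      exact Nat.not_dvd_of_pos_of_lt (Nat.pos_of_ne_zero h0) hk
    have hf : Int.fract ((k : ℝ) / N) = k / N := by
      rw [Int.fract_eq_self]
      refine ⟨by positivity, ?_⟩
      rw [div_lt_one hN]
      exact_mod_cast hk
    simp [sawtooth, hd, h0, hf]

lemma sum_sawtooth_mul_sin {N : ℕ} (hN : 0 < N) (q : ℕ) :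
    ∑ k ∈ range N, sawtooth N k * sin (2 * π * q * k / N) = -(cot (π * q / N) / 2) := by
  have hN' : (N : ℝ) ≠ 0 := by positivity
  set θ : ℝ := 2 * π * q / N with hθ
  have hNθ : (N : ℝ) * θ = q * (2 * π) := by rw [hθ]; field_simp
  have harg : ∀ k : ℕ, 2 * π * q * k / N = k * θ := fun k => by rw [hθ]; ring
  have hhalf : π * q / N = θ / 2 := by rw [hθ]; ring
  have hodd : ∑ k ∈ range N, sin (k * θ) = 0 := by
    have h := sum_range_comp_mul_of_gcd_eq_one hN (z := -1) (by simp)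
      (fun m => sin (m * θ)) (fun a b hab => by
        obtain ⟨c, hc⟩ := hab.dvd
        have hb : (b : ℝ) = a + N * c := by
          rw [sub_eq_iff_eq_add'] at hc
          exact_mod_cast hc
        have : (b : ℝ) * θ = a * θ + (c * q : ℤ) * (2 * π) := by
          rw [hb]
          push_cast
          linear_combination (c : ℝ) * hNθ
        simp only [this, sin_add_int_mul_two_pi])
    simp only [one_mul, Int.cast_neg, neg_mul, sin_neg, Int.cast_natCast,
      sum_neg_distrib] at h
    linarith
  have hmain : ∑ k ∈ range N, sawtooth N k * sin (2 * π * q * k / N)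
      = (1 / N) * ∑ k ∈ range N, (k : ℝ) * sin (k * θ) := by
    have : ∀ k ∈ range N, sawtooth N k * sin (2 * π * q * k / N)
        = (1 / N) * ((k : ℝ) * sin (k * θ)) - 1 / 2 * sin (k * θ) := by
      intro k hk
      rw [harg, sawtooth_natCast_of_lt (mem_range.mp hk)]
      split_ifs with h
      · simp [h]
      · ring
    rw [sum_congr rfl this, sum_sub_distrib, ← mul_sum, ← mul_sum, hodd]
    ring
  rw [hmain, hhalf, Real.cot_eq_cos_div_sin]
  by_cases hs : sin (θ / 2) = 0
  · rw [hs, div_zero]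
    have hz : ∀ k : ℕ, sin (k * θ) = 0 := by
      obtain ⟨n, hn⟩ := sin_eq_zero_iff.mp hs
      intro k
      rw [sin_eq_zero_iff]
      refine ⟨2 * k * n, ?_⟩
      push_cast
      linear_combination (2 * k : ℝ) * hn
    simp [hz]
  · have h := sum_range_mul_sin θ N
    have hsinq : sin (q * (2 * π)) = 0 := by simpa using sin_nat_mul_two_pi_sub 0 q
    rw [hNθ, sin_nat_mul_two_pi_sub, hsinq, mul_zero, sub_zero] at h
    have h2 : sin θ = 2 * sin (θ / 2) * cos (θ / 2) := by
      rw [← sin_two_mul, mul_div_cancel₀ _ two_ne_zero]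
    rw [h2] at h
    have h3 : (∑ k ∈ range N, (k : ℝ) * sin (k * θ)) * (2 * sin (θ / 2))
        = -(N * cos (θ / 2)) := by
      apply mul_right_cancel₀ hs
      linear_combination h / 2
    field_simp
    linarith

lemma hasSum_sawtooth_sawtooth_periodicB2 {N : ℕ} (hN : 0 < N) (w : ℕ) :
    HasSum (fun h : ℕ => 1 / (4 * π ^ 2) * (if 1 ≤ h ∧ ¬ (N ∣ h) then
        cot (π * h * w / N) ^ 2 / (h : ℝ) ^ 2 else 0))
      (∑ k ∈ range N, ∑ l ∈ range N,
        sawtooth N k * sawtooth N l * periodicB2 ((w : ℝ) * ((k : ℝ) - l) / N)) := by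
  have hN' : (N : ℝ) ≠ 0 := by positivity
  have h := hasSum_sum (s := range N) fun k _ => hasSum_sum (s := range N) fun l _ =>
    (hasSum_periodicB2 ((w : ℝ) * ((k : ℝ) - l) / N)).mul_left (sawtooth N k * sawtooth N l)
  refine (congrArg (fun f : ℕ → ℝ => HasSum f _) (funext fun n => ?_)).mp h
  have hcos : ∑ k ∈ range N, sawtooth N k * cos (2 * π * (n * w : ℕ) * k / N) = 0 := by
    have := sum_sawtooth_mul_even hN (fun m => cos (2 * π * (n * w : ℕ) * m / N))
      (fun a b hab => by
        obtain ⟨c, hc⟩ := exists_div_eq_add_intCast_of_modEq hN hab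
        have : 2 * π * (n * w : ℕ) * b / N
            = 2 * π * (n * w : ℕ) * a / N + ((n * w : ℕ) * c : ℤ) * (2 * π) := by
          push_cast
          linear_combination (2 * π * (n * w)) * hc
        simp only [this, cos_add_int_mul_two_pi])
      (fun a => by
        rw [Int.cast_neg, mul_neg, neg_div, cos_neg])
    simpa using this
  have hsin := sum_sawtooth_mul_sin hN (n * w)
  have hexp : ∑ k ∈ range N, ∑ l ∈ range N, sawtooth N k * sawtooth N l *
        (1 / π ^ 2 * (cos (2 * π * n * ((w : ℝ) * ((k : ℝ) - l) / N)) / (n : ℝ) ^ 2))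
      = 1 / π ^ 2 / (n : ℝ) ^ 2 *
        ((∑ k ∈ range N, sawtooth N k * cos (2 * π * (n * w : ℕ) * k / N)) *
            (∑ k ∈ range N, sawtooth N k * cos (2 * π * (n * w : ℕ) * k / N))
          + (∑ k ∈ range N, sawtooth N k * sin (2 * π * (n * w : ℕ) * k / N)) *
            (∑ k ∈ range N, sawtooth N k * sin (2 * π * (n * w : ℕ) * k / N))) := by
    rw [sum_mul_sum, sum_mul_sum, ← sum_add_distrib, mul_sum]
    refine sum_congr rfl fun k _ => ?_
    rw [← sum_add_distrib, mul_sum]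
    refine sum_congr rfl fun l _ => ?_
    have : 2 * π * n * ((w : ℝ) * ((k : ℝ) - l) / N)
        = 2 * π * (n * w : ℕ) * k / N - 2 * π * (n * w : ℕ) * l / N := by
      push_cast
      ring
    rw [this, cos_sub]
    ring
  rw [hexp, hcos, hsin]
  split_ifs with hc
  · have : π * (n * w : ℕ) / N = π * n * w / N := by push_cast; ring
    rw [this]
    ring
  · by_cases hn : n = 0
    · simp [hn]
    · have hd : N ∣ n := by
        by_contra hd
        exact hc ⟨Nat.pos_of_ne_zero hn, hd⟩
      obtain ⟨c, rfl⟩ := hd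
      have : π * (N * c * w : ℕ) / N = ((c * w : ℕ) : ℝ) * π := by
        push_cast
        field_simp
      rw [this, Real.cot_eq_cos_div_sin, sin_nat_mul_pi]
      simp

/-- The `k`-th node of the rank-one lattice with generating vector `z`. -/
noncomputable def latticePoint (N : ℕ) (z : Fin 2 → ℤ) (k : ℕ) (j : Fin 2) : ℝ :=
  Int.fract ((z j : ℝ) * k / N)

/-- The vertex of the unit square with indicator `a`. -/
def vertex (a : Fin 2 → Bool) (j : Fin 2) : ℝ := if a j then 1 else 0

/-- The optimal weight attached to the vertex `a`. -/
noncomputable def vertexWeight (N : ℕ) (z : Fin 2 → ℤ) (a : Fin 2 → Bool) : ℝ :=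
  1 / 4 - (1 / (N : ℝ)) * ∑ k ∈ Icc 1 (N - 1),
    ((∏ j ∈ univ.filter (fun j => a j = true), latticePoint N z k j) *
      ∏ j ∈ univ.filter (fun j => a j = false), (1 - latticePoint N z k j))

/-- The optimal vertex modified lattice rule. -/
noncomputable def vertexRule (N : ℕ) (z : Fin 2 → ℤ) (f : (Fin 2 → ℝ) → ℝ) : ℝ :=
  ∑ a, vertexWeight N z a * f (vertex a) +
    ∑ k ∈ Icc 1 (N - 1), 1 / (N : ℝ) * f (latticePoint N z k)

lemma vertexRule_add (N : ℕ) (z : Fin 2 → ℤ) (f g : (Fin 2 → ℝ) → ℝ) :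
    vertexRule N z (fun x => f x + g x) = vertexRule N z f + vertexRule N z g := by
  simp only [vertexRule, mul_add, sum_add_distrib]
  ring

lemma vertexRule_const_mul (N : ℕ) (z : Fin 2 → ℤ) (c : ℝ) (f : (Fin 2 → ℝ) → ℝ) :
    vertexRule N z (fun x => c * f x) = c * vertexRule N z f := by
  simp only [vertexRule, mul_add, mul_sum, mul_left_comm]

lemma sum_fin_two_bool (f : (Fin 2 → Bool) → ℝ) :
    ∑ a, f a = f ![false, false] + f ![false, true] + f ![true, false] + f ![true, true] := by
  rw [← (finTwoArrowEquiv Bool).symm.sum_comp, Fintype.sum_prod_type]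
  simp only [Fintype.sum_bool, finTwoArrowEquiv_symm_apply]
  ring

lemma sum_Icc_eq_sum_range {N : ℕ} (hN : 0 < N) (f : ℕ → ℝ) :
    ∑ k ∈ Icc 1 (N - 1), f k = ∑ k ∈ range N, f k - f 0 := by
  obtain ⟨n, rfl⟩ := Nat.exists_eq_add_of_lt hN
  rw [sum_range_eq_add_Ico _ hN]
  have : Icc 1 (0 + n + 1 - 1) = Ico 1 (0 + n + 1) := by
    ext
    simp only [mem_Icc, mem_Ico]
    omega
  rw [this]
  ring

lemma latticePoint_eq_sawtooth_add {N : ℕ} {z : Fin 2 → ℤ} {j : Fin 2}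
    (hz : Int.gcd (z j) N = 1) {k : ℕ} (hk : k ∈ Icc 1 (N - 1)) :
    latticePoint N z k j = sawtooth N (z j * k) + 1 / 2 := by
  rw [mem_Icc] at hk
  have : ¬ (N : ℤ) ∣ z j * k := by
    intro h
    have h2 : (N : ℤ) ∣ k := IsCoprime.dvd_of_dvd_mul_left
      (Int.isCoprime_iff_gcd_eq_one.mpr (by rwa [Int.gcd_comm])) h
    have := Nat.le_of_dvd (by omega) (Int.natCast_dvd_natCast.mp h2)
    omega
  simp [sawtooth, this, latticePoint]

lemma latticePoint_zero (N : ℕ) (z : Fin 2 → ℤ) : latticePoint N z 0 = fun _ => 0 := by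
  funext j
  simp [latticePoint]

lemma sum_sawtooth_mul_left {N : ℕ} (hN : 0 < N) {c : ℤ} (hc : Int.gcd c N = 1) :
    ∑ k ∈ range N, sawtooth N (c * k) = 0 := by
  rw [sum_range_comp_mul_of_gcd_eq_one hN hc _ fun a b => sawtooth_eq_of_modEq hN]
  simpa using sum_sawtooth_mul_even hN (fun _ => 1) (fun _ _ _ => rfl) (fun _ => rfl)

lemma sum_latticePoint {N : ℕ} (hN : 0 < N) {z : Fin 2 → ℤ} {j : Fin 2}
    (hz : Int.gcd (z j) N = 1) :
    ∑ k ∈ Icc 1 (N - 1), latticePoint N z k j = ((N : ℝ) - 1) / 2 := by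
  rw [sum_congr rfl fun k hk => latticePoint_eq_sawtooth_add hz hk,
    sum_Icc_eq_sum_range hN fun k => sawtooth N (z j * k) + 1 / 2, sum_add_distrib,
    sum_sawtooth_mul_left hN hz]
  simp [sawtooth]
  ring

lemma vertexRule_eq {N : ℕ} (hN : 0 < N) {z : Fin 2 → ℤ} (hz : ∀ j, Int.gcd (z j) N = 1)
    (f : (Fin 2 → ℝ) → ℝ) :
    vertexRule N z f =
      (1 / N * ∑ k ∈ Icc 1 (N - 1), f (latticePoint N z k))
      + (1 / 4 - 1 / N * ∑ k ∈ Icc 1 (N - 1), latticePoint N z k 0 * latticePoint N z k 1) *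
        (f ![0, 0] + f ![1, 1])
      + (1 / 4 - 1 / N * (((N : ℝ) - 1) / 2
        - ∑ k ∈ Icc 1 (N - 1), latticePoint N z k 0 * latticePoint N z k 1)) *
        (f ![0, 1] + f ![1, 0]) := by
  have hv : ∀ a b, vertex ![a, b] = ![if a then 1 else 0, if b then 1 else 0] := by
    intro a b
    funext j
    fin_cases j <;> rfl
  have h0 := sum_latticePoint hN (hz 0)
  have h1 := sum_latticePoint hN (hz 1)
  have hc : ∑ k ∈ Icc 1 (N - 1), (1 : ℝ) = N - 1 := by
    simp [Nat.cast_sub (Nat.one_le_iff_ne_zero.mpr hN.ne')]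
  have hcomm : ∀ k, latticePoint N z k 1 * latticePoint N z k 0
      = latticePoint N z k 0 * latticePoint N z k 1 := fun k => mul_comm _ _
  simp only [vertexRule, sum_fin_two_bool, hv, vertexWeight, prod_filter, Fin.prod_univ_two]
  simp [-one_div, mul_sub, sub_mul, sum_sub_distrib, h0, h1, -sum_const, hc, ← mul_sum, hcomm]
  ring

lemma vertexRule_of_periodic {N : ℕ} (hN : 0 < N) {z : Fin 2 → ℤ}
    (hz : ∀ j, Int.gcd (z j) N = 1) (f : (Fin 2 → ℝ) → ℝ)
    (h01 : f ![0, 1] = f ![0, 0]) (h10 : f ![1, 0] = f ![0, 0]) (h11 : f ![1, 1] = f ![0, 0]) :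
    vertexRule N z f = 1 / N * ∑ k ∈ range N, f (latticePoint N z k) := by
  have hN' : (N : ℝ) ≠ 0 := by positivity
  have h0 : latticePoint N z 0 = ![0, 0] := by
    rw [latticePoint_zero]
    funext j
    fin_cases j <;> rfl
  rw [vertexRule_eq hN hz, sum_Icc_eq_sum_range hN fun k => f (latticePoint N z k),
    h01, h10, h11, h0]
  field_simp
  ring

/-- On a product of a centred linear factor and a factor periodic in the other variable, the rule
only sees the sawtooth part. -/
lemma vertexRule_linear_mul_periodic {N : ℕ} (hN : 0 < N) {z : Fin 2 → ℤ}
    (hz : ∀ j, Int.gcd (z j) N = 1) (i : Fin 2) (f : ℝ → ℝ) (hf : f 1 = f 0) :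
    vertexRule N z (fun x => (x i - 1 / 2) * f (x (1 - i)))
      = 1 / N * ∑ k ∈ range N, sawtooth N (z i * k) * f (latticePoint N z k (1 - i)) := by
  have h : ∑ k ∈ Icc 1 (N - 1), (latticePoint N z k i - 1 / 2) * f (latticePoint N z k (1 - i))
      = ∑ k ∈ range N, sawtooth N (z i * k) * f (latticePoint N z k (1 - i)) := by
    have h2 := sum_Icc_eq_sum_range hN
      fun k => sawtooth N (z i * k) * f (latticePoint N z k (1 - i))
    have h3 : sawtooth N (z i * (0 : ℕ)) = 0 := by simp [sawtooth]
    rw [h3, zero_mul, sub_zero] at h2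
    rw [← h2]
    refine sum_congr rfl fun k hk => ?_
    rw [latticePoint_eq_sawtooth_add (hz i) hk, add_sub_cancel_right]
  rw [vertexRule_eq hN hz, h]
  fin_cases i <;> simp [hf] <;> ring

lemma vertexRule_linear {N : ℕ} (hN : 0 < N) {z : Fin 2 → ℤ}
    (hz : ∀ j, Int.gcd (z j) N = 1) (i : Fin 2) :
    vertexRule N z (fun x => x i - 1 / 2) = 0 := by
  have h := vertexRule_linear_mul_periodic hN hz i (fun _ => 1) rfl
  simp only [mul_one, sum_sawtooth_mul_left hN (hz i), mul_zero] at h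
  exact h

lemma vertexRule_bilinear {N : ℕ} (hN : 0 < N) {z : Fin 2 → ℤ}
    (hz : ∀ j, Int.gcd (z j) N = 1) :
    vertexRule N z (fun x => (x 0 - 1 / 2) * (x 1 - 1 / 2)) = 0 := by
  have hN' : (N : ℝ) ≠ 0 := by positivity
  have h0 := sum_latticePoint hN (hz 0)
  have h1 := sum_latticePoint hN (hz 1)
  have hc : ∑ k ∈ Icc 1 (N - 1), (1 : ℝ) = N - 1 := by
    simp [Nat.cast_sub (Nat.one_le_iff_ne_zero.mpr hN.ne')]
  have h : ∑ k ∈ Icc 1 (N - 1), (latticePoint N z k 0 - 1 / 2) * (latticePoint N z k 1 - 1 / 2)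
      = ∑ k ∈ Icc 1 (N - 1), latticePoint N z k 0 * latticePoint N z k 1 - (N - 1) / 4 := by
    have : ∀ k ∈ Icc 1 (N - 1),
        (latticePoint N z k 0 - 1 / 2) * (latticePoint N z k 1 - 1 / 2)
        = latticePoint N z k 0 * latticePoint N z k 1 - 1 / 2 * latticePoint N z k 0
          - 1 / 2 * latticePoint N z k 1 + 1 / 4 * 1 := fun k _ => by ring
    rw [sum_congr rfl this, sum_add_distrib, sum_sub_distrib, sum_sub_distrib, ← mul_sum,
      ← mul_sum, ← mul_sum, h0, h1, hc]
    ring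
  rw [vertexRule_eq hN hz, h]
  simp
  field_simp
  ring

lemma periodicB2_one_sub (y : ℝ) : periodicB2 (1 - y) = periodicB2 (0 - y) := by
  rw [← periodicB2_add_intCast (0 - y) 1]
  congr 1
  push_cast
  ring

lemma periodicB2_sub_one (x : ℝ) : periodicB2 (x - 1) = periodicB2 (x - 0) := by
  rw [← periodicB2_add_intCast (x - 1) 1]
  congr 1
  push_cast
  ring

lemma periodicB2_latticePoint_sub (N : ℕ) (z : Fin 2 → ℤ) (k l : ℕ) (j : Fin 2) :
    periodicB2 (latticePoint N z k j - latticePoint N z l j)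
      = periodicB2 ((z j : ℝ) * ((k : ℝ) - l) / N) := by
  rw [← periodicB2_add_intCast (latticePoint N z k j - latticePoint N z l j)
    (⌊(z j : ℝ) * k / N⌋ - ⌊(z j : ℝ) * l / N⌋)]
  congr 1
  simp only [latticePoint, Int.fract]
  push_cast
  ring

lemma vertexRule_vertexRule_mixed {N : ℕ} (hN : 0 < N) {z : Fin 2 → ℤ}
    (hz : ∀ j, Int.gcd (z j) N = 1) (i : Fin 2) {w : ℕ}
    (hw : (w : ℤ) * z i ≡ z (1 - i) [ZMOD (N : ℤ)]) :
    vertexRule N z (fun x => vertexRule N z fun y =>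
        (x i - 1 / 2) * ((y i - 1 / 2) * periodicB2 (x (1 - i) - y (1 - i))))
      = 1 / (4 * π ^ 2 * (N : ℝ) ^ 2) * ∑' h : ℕ, if 1 ≤ h ∧ ¬ (N ∣ h) then
          cot (π * h * w / N) ^ 2 / (h : ℝ) ^ 2 else 0 := by
  have hcong : ∀ m n m' n' : ℤ, m ≡ m' [ZMOD (N : ℤ)] → n ≡ n' [ZMOD (N : ℤ)] →
      periodicB2 ((w : ℝ) * ((m : ℝ) - n) / N) = periodicB2 ((w : ℝ) * ((m' : ℝ) - n') / N) := by
    intro m n m' n' hm hn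
    obtain ⟨c, hc⟩ := exists_div_eq_add_intCast_of_modEq hN
      ((hm.sub hn).mul_left (w : ℤ))
    push_cast at hc
    rw [hc, periodicB2_add_intCast]
  have hpt : ∀ k l : ℕ, periodicB2 (latticePoint N z k (1 - i) - latticePoint N z l (1 - i))
      = periodicB2 ((w : ℝ) * (((z i * k : ℤ) : ℝ) - (z i * l : ℤ)) / N) := by
    intro k l
    rw [periodicB2_latticePoint_sub]
    obtain ⟨c, hc⟩ := exists_div_eq_add_intCast_of_modEq hN (hw.mul_right ((k : ℤ) - l))
    push_cast at hc
    rw [hc, periodicB2_add_intCast]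
    congr 1
    push_cast
    ring
  have hinner : ∀ x : Fin 2 → ℝ, (vertexRule N z fun y =>
        (x i - 1 / 2) * ((y i - 1 / 2) * periodicB2 (x (1 - i) - y (1 - i))))
      = (x i - 1 / 2) * (1 / N * ∑ l ∈ range N, sawtooth N (z i * l) *
          periodicB2 (x (1 - i) - latticePoint N z l (1 - i))) := by
    intro x
    rw [vertexRule_const_mul, vertexRule_linear_mul_periodic hN hz i
      (fun t => periodicB2 (x (1 - i) - t)) (periodicB2_sub_one _)]
  simp only [hinner]
  rw [vertexRule_linear_mul_periodic hN hz i (fun t => 1 / N * ∑ l ∈ range N,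
    sawtooth N (z i * l) * periodicB2 (t - latticePoint N z l (1 - i)))
    (by simp only [periodicB2_one_sub])]
  simp only [hpt]
  have hswap : ∑ k ∈ range N, sawtooth N (z i * k) * (1 / N * ∑ l ∈ range N,
        sawtooth N (z i * l) *
          periodicB2 ((w : ℝ) * (((z i * k : ℤ) : ℝ) - (z i * l : ℤ)) / N))
      = 1 / N * ∑ k ∈ range N, ∑ l ∈ range N,
        sawtooth N k * sawtooth N l * periodicB2 ((w : ℝ) * ((k : ℝ) - l) / N) := by
    have h1 : ∀ m : ℤ, ∑ l ∈ range N, sawtooth N (z i * l) *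
          periodicB2 ((w : ℝ) * ((m : ℝ) - (z i * l : ℤ)) / N)
        = ∑ l ∈ range N, sawtooth N l * periodicB2 ((w : ℝ) * ((m : ℝ) - l) / N) := by
      intro m
      have := sum_range_comp_mul_of_gcd_eq_one hN (hz i)
        (fun n => sawtooth N n * periodicB2 ((w : ℝ) * ((m : ℝ) - n) / N))
        (fun a b hab => by
          simp only [sawtooth_eq_of_modEq hN hab, hcong m a m b rfl hab])
      simpa using this
    simp only [h1]
    have := sum_range_comp_mul_of_gcd_eq_one hN (hz i)
      (fun m => sawtooth N m * (1 / N * ∑ l ∈ range N, sawtooth N l *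
        periodicB2 ((w : ℝ) * ((m : ℝ) - l) / N)))
      (fun a b hab => by
        simp only [sawtooth_eq_of_modEq hN hab]
        congr 2
        refine sum_congr rfl fun l _ => ?_
        have := hcong a l b l hab rfl
        push_cast at this
        rw [this])
    rw [this, mul_sum]
    refine sum_congr rfl fun k _ => ?_
    rw [mul_left_comm, mul_sum]
    push_cast
    congr 1
    exact sum_congr rfl fun l _ => by ring
  rw [hswap, ← (hasSum_sawtooth_sawtooth_periodicB2 hN w).tsum_eq, tsum_mul_left]
  ring

/-- For `N ≥ 3`, a generating vector `z ∈ ℤ²` with `gcd(z_j,N) = 1`, weights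
`γ₁, γ₂ > 0`, and `w_j ∈ {1,…,N−1}` with `w₁z₁ ≡ z₂` and `w₂z₂ ≡ z₁ (mod N)`, the squared
worst-case error of the optimal vertex modified lattice rule `Q*` in the two-dimensional
unanchored Sobolev space equals the squared worst-case error of the lattice rule in the
Korobov space with weights `γ/(2π)²` plus the cotangent mixture term
`(γ₁γ₂/(8π²N²)) ∑_{j∈{1,2}} ∑_{h ≥ 1, N ∤ h} cot²(πhw_j/N)/h²`. -/
theorem stmt6 (N : ℕ) (hN : 3 ≤ N) (z : Fin 2 → ℤ)
    (hz : ∀ j, Int.gcd (z j) N = 1)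
    (γ : Fin 2 → ℝ) (hγ : ∀ j, 0 < γ j)
    (w : Fin 2 → ℕ) (hwrange : ∀ j, 1 ≤ w j ∧ w j ≤ N - 1)
    (hw : ∀ j, (w j : ℤ) * z j ≡ z (1 - j) [ZMOD (N : ℤ)]) :
    let B1 : ℝ → ℝ := fun t => t - 1 / 2
    let B2 : ℝ → ℝ := fun t => t ^ 2 - t + 1 / 6
    let K : (Fin 2 → ℝ) → (Fin 2 → ℝ) → ℝ := fun x y =>
      ∏ j, (1 + γ j * B1 (x j) * B1 (y j) + γ j * B2 (Int.fract (x j - y j)) / 2)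
    let v : (Fin 2 → Bool) → Fin 2 → ℝ := fun a j => if a j then 1 else 0
    let P : ℕ → Fin 2 → ℝ := fun k j => Int.fract ((z j : ℝ) * k / N)
    let W : (Fin 2 → Bool) → ℝ := fun a =>
      1 / 4 - (1 / (N : ℝ)) * ∑ k ∈ Finset.Icc 1 (N - 1),
        ((∏ j ∈ Finset.univ.filter (fun j => a j = true), P k j) *
          ∏ j ∈ Finset.univ.filter (fun j => a j = false), (1 - P k j))
    ((∑ a : Fin 2 → Bool, ∑ b : Fin 2 → Bool, W a * W b * K (v a) (v b))
        + (∑ a : Fin 2 → Bool, ∑ k ∈ Finset.Icc 1 (N - 1), W a * (1 / (N : ℝ)) * K (v a) (P k))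
        + (∑ k ∈ Finset.Icc 1 (N - 1), ∑ a : Fin 2 → Bool, (1 / (N : ℝ)) * W a * K (P k) (v a))
        + (∑ k ∈ Finset.Icc 1 (N - 1), ∑ l ∈ Finset.Icc 1 (N - 1),
            (1 / (N : ℝ)) * (1 / (N : ℝ)) * K (P k) (P l))) - 1
      = (((1 / (N : ℝ) ^ 2) * ∑ k ∈ Finset.range N, ∑ l ∈ Finset.range N,
            ∏ j, (1 + γ j * B2 (Int.fract ((z j : ℝ) * ((k : ℝ) - (l : ℝ)) / N)) / 2)) - 1)
        + (γ 0 * γ 1 / (8 * π ^ 2 * (N : ℝ) ^ 2)) *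
            ∑ j : Fin 2, ∑' h : ℕ, if 1 ≤ h ∧ ¬ (N ∣ h) then
              Real.cot (π * h * w j / N) ^ 2 / (h : ℝ) ^ 2 else 0 := by
  intro B1 B2 K v P W
  have hN0 : 0 < N := by omega
  have hfub : (∑ a : Fin 2 → Bool, ∑ b : Fin 2 → Bool, W a * W b * K (v a) (v b))
        + (∑ a : Fin 2 → Bool, ∑ k ∈ Finset.Icc 1 (N - 1), W a * (1 / (N : ℝ)) * K (v a) (P k))
        + (∑ k ∈ Finset.Icc 1 (N - 1), ∑ a : Fin 2 → Bool, (1 / (N : ℝ)) * W a * K (P k) (v a))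
        + (∑ k ∈ Finset.Icc 1 (N - 1), ∑ l ∈ Finset.Icc 1 (N - 1),
            (1 / (N : ℝ)) * (1 / (N : ℝ)) * K (P k) (P l))
      = vertexRule N z (fun x => vertexRule N z fun y => K x y) := by
    change _ = ∑ a, W a * (∑ b, W b * K (v a) (v b)
        + ∑ l ∈ Icc 1 (N - 1), 1 / (N : ℝ) * K (v a) (P l))
      + ∑ k ∈ Icc 1 (N - 1), 1 / (N : ℝ) * (∑ b, W b * K (P k) (v b)
        + ∑ l ∈ Icc 1 (N - 1), 1 / (N : ℝ) * K (P k) (P l))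
    simp only [mul_add, mul_sum, sum_add_distrib, mul_assoc]
    ring
  have hsplit : ∀ x y, K x y =
      (1 + γ 0 * periodicB2 (x 0 - y 0) / 2) * (1 + γ 1 * periodicB2 (x 1 - y 1) / 2)
      + (γ 0 * (x 0 - 1 / 2)) * (y 0 - 1 / 2) + (γ 1 * (x 1 - 1 / 2)) * (y 1 - 1 / 2)
      + (γ 0 * γ 1 * ((x 0 - 1 / 2) * (x 1 - 1 / 2))) * ((y 0 - 1 / 2) * (y 1 - 1 / 2))
      + (γ 0 * γ 1 / 2) * ((x 0 - 1 / 2) * ((y 0 - 1 / 2) * periodicB2 (x 1 - y 1)))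
      + (γ 0 * γ 1 / 2) * ((x 1 - 1 / 2) * ((y 1 - 1 / 2) * periodicB2 (x 0 - y 0))) := by
    intro x y
    simp only [K, B1, B2, Fin.prod_univ_two, periodicB2]
    ring
  have hperiodic : vertexRule N z (fun x => vertexRule N z fun y =>
        (1 + γ 0 * periodicB2 (x 0 - y 0) / 2) * (1 + γ 1 * periodicB2 (x 1 - y 1) / 2))
      = (1 / (N : ℝ) ^ 2) * ∑ k ∈ Finset.range N, ∑ l ∈ Finset.range N,
            ∏ j, (1 + γ j * B2 (Int.fract ((z j : ℝ) * ((k : ℝ) - (l : ℝ)) / N)) / 2) := by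
    have hinner : ∀ x : Fin 2 → ℝ, (vertexRule N z fun y =>
          (1 + γ 0 * periodicB2 (x 0 - y 0) / 2) * (1 + γ 1 * periodicB2 (x 1 - y 1) / 2))
        = 1 / N * ∑ l ∈ range N, (1 + γ 0 * periodicB2 (x 0 - latticePoint N z l 0) / 2) *
          (1 + γ 1 * periodicB2 (x 1 - latticePoint N z l 1) / 2) := fun x =>
      vertexRule_of_periodic hN0 hz _ (by simp [periodicB2_sub_one])
        (by simp [periodicB2_sub_one]) (by simp [periodicB2_sub_one])
    simp only [hinner]
    rw [vertexRule_of_periodic hN0 hz _ (by simp [periodicB2_one_sub])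
      (by simp [periodicB2_one_sub]) (by simp [periodicB2_one_sub]), ← mul_sum, ← mul_assoc]
    have hB : ∀ t, B2 (Int.fract t) = periodicB2 t := fun _ => rfl
    simp only [periodicB2_latticePoint_sub, Fin.prod_univ_two, hB]
    ring
  have hm0 := vertexRule_vertexRule_mixed hN0 hz 0 (hw 0)
  have hm1 := vertexRule_vertexRule_mixed hN0 hz 1 (hw 1)
  simp only [sub_zero, sub_self] at hm0 hm1
  rw [hfub]
  simp only [hsplit, vertexRule_add, vertexRule_const_mul, vertexRule_linear hN0 hz,
    vertexRule_bilinear hN0 hz, mul_zero]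
  simp only [vertexRule_const_mul] at hm0 hm1 hperiodic
  rw [hperiodic, hm0, hm1, Fin.sum_univ_two]
  have h0 : vertexRule N z (fun _ => 0) = 0 := by simp [vertexRule]
  rw [h0]
  ring
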